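/- The limiting function of the B-spline kernels is a Gaussian: setting σ_n = √((n+1)/12), for every x ∈ ℝ one has σ_n · φ_n(σ_n · x) → (1/√(2π)) · e^{−x²/2} as n → ∞. -/

import Mathlib

open MeasureTheory

/-- The zeroth-order B-spline kernel: the indicator function of `[-1/2, 1/2]`. -/
noncomputable def bspline0 : ℝ → ℝ :=
  Set.indicator (Set.Icc (-(1 / 2) : ℝ) (1 / 2)) (fun _ => 1)

/-- The B-spline kernels, defined recursively by convolution against `bspline0`. -/
noncomputable def bspline : ℕ → ℝ → ℝ
  | 0 => bspline0
  | n + 1 => fun r => ∫ s : ℝ, bspline n (r - s) * bspline0 s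

lemma sinc_sq_bound (u : ℝ) : Real.sinc u ^ 2 ≤ (1 + u ^ 2 / 4)⁻¹ := by
  by_cases hu : u = 0
  · subst hu; simp
  have hu2 : 0 < u ^ 2 := by positivity
  rw [Real.sinc_of_ne_zero hu, div_pow, ← one_div, div_le_div_iff₀ hu2 (by positivity), one_mul]
  have hs1 : Real.sin u ^ 2 ≤ 1 := Real.sin_sq_le_one u
  by_cases hb : |u| ≤ 3
  · have hpi := Real.pi_gt_three
    have ⟨h1, h2⟩ := abs_le.mp hb
    have hc := Real.cos_le_one_div_sqrt_sq_add_one (x := u / 2) (by linarith) (by linarith)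
    have hc0 : 0 ≤ Real.cos (u / 2) :=
      Real.cos_nonneg_of_neg_pi_div_two_le_of_le (by linarith) (by linarith)
    have hc2 : Real.cos (u / 2) ^ 2 ≤ (1 / √((u / 2) ^ 2 + 1)) ^ 2 := by gcongr
    rw [div_pow, Real.sq_sqrt (by positivity), one_pow, le_div_iff₀ (by positivity)] at hc2
    have hs : Real.sin (u / 2) ^ 2 ≤ (u / 2) ^ 2 := sq_le_sq.mpr Real.abs_sin_le_abs
    have hd : Real.sin u = 2 * Real.sin (u / 2) * Real.cos (u / 2) := by
      rw [← Real.sin_two_mul]; congr 1; ring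
    rw [hd]
    calc (2 * Real.sin (u / 2) * Real.cos (u / 2)) ^ 2 * (1 + u ^ 2 / 4)
        = 4 * Real.sin (u / 2) ^ 2 * (Real.cos (u / 2) ^ 2 * ((u / 2) ^ 2 + 1)) := by ring
      _ ≤ 4 * (u / 2) ^ 2 * 1 := by gcongr
      _ = u ^ 2 := by ring
  · push Not at hb
    have : 9 < u ^ 2 := by
      rw [← sq_abs]; nlinarith
    nlinarith

lemma sinc_pow_bound (u : ℝ) (m : ℕ) (hm : 2 ≤ m) :
    |Real.sinc u ^ m| ≤ (1 + m * u ^ 2 / 8)⁻¹ := by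
  have hm' : (2 : ℝ) ≤ m := by exact_mod_cast hm
  have h1 : |Real.sinc u ^ m| = (Real.sinc u ^ 2) ^ ((m : ℝ) / 2) := by
    rw [abs_pow, ← sq_abs, ← Real.rpow_natCast (|Real.sinc u|) 2, ← Real.rpow_mul (abs_nonneg _),
      ← Real.rpow_natCast]
    congr 1; push_cast; ring
  rw [h1]
  calc (Real.sinc u ^ 2) ^ ((m : ℝ) / 2) ≤ ((1 + u ^ 2 / 4)⁻¹) ^ ((m : ℝ) / 2) :=
        Real.rpow_le_rpow (by positivity) (sinc_sq_bound u) (by positivity)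
    _ = ((1 + u ^ 2 / 4) ^ ((m : ℝ) / 2))⁻¹ := Real.inv_rpow (by positivity) _
    _ ≤ (1 + m * u ^ 2 / 8)⁻¹ := by
        gcongr
        have := one_add_mul_self_le_rpow_one_add (s := u ^ 2 / 4) (p := (m : ℝ) / 2)
          (by nlinarith [sq_nonneg u]) (by linarith)
        linarith

lemma sinc_taylor {u : ℝ} (hu : |u| ≤ 1) : |Real.sinc u - 1 + u ^ 2 / 6| ≤ u ^ 4 / 100 := by
  by_cases h : u = 0
  · subst h; simp
  have := Real.sin_bound hu
  rw [Real.sinc_of_ne_zero h]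
  have e : Real.sin u - (u - u ^ 3 / 6) = u * (Real.sin u / u - 1 + u ^ 2 / 6) := by
    field_simp; ring
  rw [e, abs_mul] at this
  have hp : 0 < |u| := abs_pos.mpr h
  have e2 : |u| ^ 5 / 100 = |u| * (u ^ 4 / 100) := by
    have : u ^ 4 = |u| ^ 4 := (Even.pow_abs (by decide) u).symm
    rw [this]; ring
  rw [e2] at this
  exact le_of_mul_le_mul_left this hp

lemma sigma_sq (t : ℝ) (m : ℕ) :
    (t / (2 * √((m : ℝ) / 12))) ^ 2 = 3 * t ^ 2 / m := by
  rw [div_pow, mul_pow, Real.sq_sqrt (by positivity)]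
  by_cases h : (m : ℝ) = 0
  · simp [h]
  · field_simp; ring

lemma sinc_pow_tendsto (t : ℝ) :
    Filter.Tendsto (fun m : ℕ => Real.sinc (t / (2 * √((m : ℝ) / 12))) ^ m) Filter.atTop
      (nhds (Real.exp (-t ^ 2 / 2))) := by
  have key : Filter.Tendsto (fun m : ℕ => (m : ℝ) * (Real.sinc (t / (2 * √((m : ℝ) / 12))) - 1))
      Filter.atTop (nhds (-t ^ 2 / 2)) := by
    rw [tendsto_iff_norm_sub_tendsto_zero]
    have hlim : Filter.Tendsto (fun m : ℕ => (9 * t ^ 4 / 100) / (m : ℝ)) Filter.atTop (nhds 0) :=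
      tendsto_const_div_atTop_nhds_zero_nat _
    refine squeeze_zero' (Filter.Eventually.of_forall fun _ => norm_nonneg _) ?_ hlim
    obtain ⟨N, hN⟩ := exists_nat_ge (3 * t ^ 2)
    filter_upwards [Filter.eventually_ge_atTop (N + 1)] with m hm
    have hm0 : (0 : ℝ) < m := by exact_mod_cast (by omega : 0 < m)
    have hmN : (N : ℝ) ≤ m := by exact_mod_cast (by omega : N ≤ m)
    set u := t / (2 * √((m : ℝ) / 12)) with hu
    have hsq : u ^ 2 = 3 * t ^ 2 / m := sigma_sq t m
    have hu1 : |u| ≤ 1 := by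
      rw [← sq_le_one_iff_abs_le_one, hsq, div_le_one hm0]; linarith
    have h := sinc_taylor hu1
    have e : (m : ℝ) * (Real.sinc u - 1) - -t ^ 2 / 2 = m * (Real.sinc u - 1 + u ^ 2 / 6) := by
      rw [hsq]; field_simp; ring
    rw [e, Real.norm_eq_abs, abs_mul, abs_of_pos hm0]
    calc (m : ℝ) * _ ≤ m * (u ^ 4 / 100) := by gcongr
      _ = m * ((u ^ 2) ^ 2 / 100) := by ring
      _ = _ := by rw [hsq]; field_simp; ring
  have := Real.tendsto_one_add_pow_exp_of_tendsto key
  simpa using this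

open FourierTransform Convolution

/-- complex version -/
noncomputable def bsC (n : ℕ) : ℝ → ℂ := fun x => (bspline n x : ℂ)

lemma bspline0_integrable : Integrable bspline0 := by
  unfold bspline0
  rw [integrable_indicator_iff measurableSet_Icc]
  simp

lemma bsC_succ (n : ℕ) : bsC (n + 1) = (bsC n ⋆[ContinuousLinearMap.mul ℂ ℂ, volume] bsC 0) := by
  ext r
  rw [convolution_mul_swap]
  simp only [bsC, bspline]
  rw [← integral_complex_ofReal]
  simp

lemma bsC_integrable (n : ℕ) : Integrable (bsC n) := by
  induction n with
  | zero => exact bspline0_integrable.ofReal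
  | succ n ih => 
    rw [bsC_succ]
    exact ih.integrable_convolution _ bspline0_integrable.ofReal

lemma bspline_integrable (n : ℕ) : Integrable (bspline n) := by
  simpa [bsC] using (bsC_integrable n).re

lemma bspline_continuous (n : ℕ) : Continuous (bspline (n + 1)) := by
  have hP := intervalIntegral.continuous_primitive
    (fun a b => (bspline_integrable n).intervalIntegrable (a := a) (b := b)) 0
  have e : bspline (n + 1) = fun r => (∫ s in (0:ℝ)..(r + 1 / 2), bspline n s)
      - ∫ s in (0:ℝ)..(r - 1 / 2), bspline n s := by
    ext r
    rw [intervalIntegral.integral_interval_sub_left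
      ((bspline_integrable n).intervalIntegrable) ((bspline_integrable n).intervalIntegrable)]
    have : ∀ s, bspline n (r - s) * bspline0 s
      = Set.indicator (Set.Icc (-(1 / 2) : ℝ) (1 / 2)) (fun s => bspline n (r - s)) s := by
      intro s
      unfold bspline0
      by_cases hs : s ∈ Set.Icc (-(1 / 2) : ℝ) (1 / 2)
      · rw [Set.indicator_of_mem hs, Set.indicator_of_mem hs, mul_one]
      · rw [Set.indicator_of_notMem hs, Set.indicator_of_notMem hs, mul_zero]
    simp only [bspline, this]
    rw [integral_indicator measurableSet_Icc, integral_Icc_eq_integral_Ioc,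
      ← intervalIntegral.integral_of_le (by norm_num), intervalIntegral.integral_comp_sub_left]
    simp
  rw [e]
  exact (hP.comp (by fun_prop)).sub (hP.comp (by fun_prop))

lemma fourier_bsC0 (ξ : ℝ) : 𝓕 (bsC 0) ξ = (Real.sinc (Real.pi * ξ) : ℂ) := by
  rw [Real.fourier_real_eq_integral_exp_smul]
  have : ∀ v : ℝ, Complex.exp (↑(-2 * Real.pi * v * ξ) * Complex.I) • bsC 0 v
      = Set.indicator (Set.Icc (-(1 / 2) : ℝ) (1 / 2))
        (fun v : ℝ => Complex.exp ((-2 * Real.pi * ξ * Complex.I) * v)) v := by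
    intro v
    simp only [bsC, bspline, bspline0]
    by_cases hs : v ∈ Set.Icc (-(1 / 2) : ℝ) (1 / 2)
    · rw [Set.indicator_of_mem hs, Set.indicator_of_mem hs]
      simp only [Complex.ofReal_one, smul_eq_mul, mul_one]
      congr 1; push_cast; ring
    · rw [Set.indicator_of_notMem hs, Set.indicator_of_notMem hs]; simp
  simp only [this]
  rw [integral_indicator measurableSet_Icc, integral_Icc_eq_integral_Ioc,
      ← intervalIntegral.integral_of_le (by norm_num)]
  by_cases h : ξ = 0
  · subst h; simp; norm_num
  have hpi : (Real.pi : ℂ) ≠ 0 := by exact_mod_cast Real.pi_ne_zero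
  have hξ : (ξ : ℂ) ≠ 0 := by exact_mod_cast h
  have hc : (-2 * Real.pi * ξ * Complex.I : ℂ) ≠ 0 := by
    simp [h, Real.pi_ne_zero]
  rw [integral_exp_mul_complex hc, Real.sinc_of_ne_zero (mul_ne_zero Real.pi_ne_zero h)]
  push_cast
  rw [Complex.sin]
  have e1 : (-2 * Real.pi * ξ * Complex.I * (1 / 2) : ℂ) = -(Real.pi * ξ) * Complex.I := by ring
  have e2 : (-2 * Real.pi * ξ * Complex.I * -(1 / 2) : ℂ) = (Real.pi * ξ) * Complex.I := by ring
  rw [e1, e2]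
  field_simp
  rw [Complex.I_sq]; ring

lemma fourier_bsC (n : ℕ) (ξ : ℝ) : 𝓕 (bsC n) ξ = (Real.sinc (Real.pi * ξ) : ℂ) ^ (n + 1) := by
  induction n with
  | zero => simpa using fourier_bsC0 ξ
  | succ n ih =>
    rw [bsC_succ, Real.fourier_mul_convolution_eq (bsC_integrable n) (bsC_integrable 0), ih,
      fourier_bsC0, ← pow_succ]

lemma integrable_bound {c : ℝ} (hc : 0 < c) : Integrable (fun t : ℝ => (1 + c * t ^ 2)⁻¹) := by
  have := integrable_inv_one_add_sq.comp_mul_left' (R := √c) (by positivity)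
  simpa [mul_pow, Real.sq_sqrt hc.le] using this

lemma bsC_inversion (n : ℕ) (y : ℝ) :
    bsC (n + 1) y = ∫ ξ : ℝ, Complex.exp (2 * Real.pi * ξ * y * Complex.I) *
      (Real.sinc (Real.pi * ξ) : ℂ) ^ (n + 2) := by
  have hF : 𝓕 (bsC (n + 1)) = fun ξ : ℝ => (Real.sinc (Real.pi * ξ) : ℂ) ^ (n + 2) := by
    ext ξ; exact fourier_bsC _ _
  have hint : Integrable (𝓕 (bsC (n + 1))) := by
    rw [hF]
    refine (integrable_bound (c := ((n + 2 : ℕ) : ℝ) * Real.pi ^ 2 / 8) (by positivity)).mono'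
      ?_ (Filter.Eventually.of_forall fun ξ => ?_)
    · have := Real.continuous_sinc
      exact (by fun_prop : Continuous _).aestronglyMeasurable
    · have := sinc_pow_bound (Real.pi * ξ) (n + 2) (by omega)
      rw [← Complex.ofReal_pow, Complex.norm_real, Real.norm_eq_abs]
      refine this.trans (le_of_eq ?_)
      congr 1; ring
  have hcont : Continuous (bsC (n + 1)) := Complex.continuous_ofReal.comp (bspline_continuous n)
  have := congrFun (hcont.fourierInv_fourier_eq (bsC_integrable _) hint) y
  rw [← this, hF, Real.fourierInv_eq']
  congr 1
  ext v
  simp only [smul_eq_mul]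
  congr 2
  simp
  ring

lemma scaled_inversion (n : ℕ) (x σ : ℝ) (hσ : 0 < σ) :
    (σ : ℂ) * bsC (n + 1) (σ * x) = (1 / (2 * Real.pi)) * ∫ t : ℝ, Complex.exp (Complex.I * x * t) *
      (Real.sinc (t / (2 * σ)) : ℂ) ^ (n + 2) := by
  rw [bsC_inversion]
  have h := Measure.integral_comp_mul_left (fun t : ℝ => Complex.exp (Complex.I * x * t) *
      (Real.sinc (t / (2 * σ)) : ℂ) ^ (n + 2)) (2 * Real.pi * σ)
  have e : ∀ ξ : ℝ, Complex.exp (Complex.I * x * ((2 * Real.pi * σ * ξ : ℝ) : ℂ)) *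
      (Real.sinc ((2 * Real.pi * σ * ξ) / (2 * σ)) : ℂ) ^ (n + 2) =
      Complex.exp (2 * Real.pi * ξ * ((σ * x : ℝ) : ℂ) * Complex.I) *
      (Real.sinc (Real.pi * ξ) : ℂ) ^ (n + 2) := by
    intro ξ
    have a : 2 * Real.pi * σ * ξ / (2 * σ) = Real.pi * ξ := by field_simp
    rw [a]
    congr 2
    push_cast; ring
  simp only [e] at h
  rw [h, abs_of_pos (by positivity)]
  have hpi : (Real.pi : ℂ) ≠ 0 := by exact_mod_cast Real.pi_ne_zero
  have hs : (σ : ℂ) ≠ 0 := by exact_mod_cast hσ.ne'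
  rw [Complex.real_smul]
  push_cast
  field_simp

lemma integral_tendsto (x : ℝ) :
    Filter.Tendsto (fun m : ℕ => ∫ t : ℝ, Complex.exp (Complex.I * x * t) *
      (Real.sinc (t / (2 * √((m : ℝ) / 12))) : ℂ) ^ m) Filter.atTop
      (nhds (∫ t : ℝ, Complex.exp (Complex.I * x * t) * Complex.exp (-(1 / 2) * t ^ 2))) := by
  refine tendsto_integral_filter_of_dominated_convergence (fun t : ℝ => (1 + 3 / 8 * t ^ 2)⁻¹)
    (Filter.Eventually.of_forall fun m => ?_) ?_ (integrable_bound (by norm_num)) ?_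
  · have := Real.continuous_sinc
    exact (by fun_prop : Continuous _).aestronglyMeasurable
  · filter_upwards [Filter.eventually_ge_atTop 2] with m hm
    refine Filter.Eventually.of_forall fun t => ?_
    have h := sinc_pow_bound (t / (2 * √((m : ℝ) / 12))) m hm
    have hm0 : (m : ℝ) ≠ 0 := by exact_mod_cast (by omega : m ≠ 0)
    have e : Complex.I * x * t = ((x * t : ℝ) : ℂ) * Complex.I := by push_cast; ring
    rw [norm_mul, e, Complex.norm_exp_ofReal_mul_I, one_mul, ← Complex.ofReal_pow,
      Complex.norm_real, Real.norm_eq_abs]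
    refine h.trans (le_of_eq ?_)
    rw [sigma_sq]
    congr 1; field_simp
  · refine Filter.Eventually.of_forall fun t => ?_
    refine Filter.Tendsto.mul tendsto_const_nhds ?_
    have := (Complex.continuous_ofReal.tendsto _).comp (sinc_pow_tendsto t)
    convert! this using 2
    · simp
    · push_cast; congr 1; ring

/-- The limiting function of the (suitably rescaled) B-spline kernels is the standard
Gaussian: with `σ_n = √((n+1)/12)`, `σ_n·φ_n(σ_n·x) → (1/√(2π))·e^{−x²/2}` pointwise. -/
theorem bspline_limit_gaussian (x : ℝ) :
    Filter.Tendsto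
      (fun n : ℕ =>
        Real.sqrt (((n : ℝ) + 1) / 12) * bspline n (Real.sqrt (((n : ℝ) + 1) / 12) * x))
      Filter.atTop
      (nhds ((1 / Real.sqrt (2 * Real.pi)) * Real.exp (-x ^ 2 / 2))) := by
  have h := ((integral_tendsto x).comp (Filter.tendsto_add_atTop_nat 2)).const_mul
    (1 / (2 * Real.pi) : ℂ)
  rw [fourierIntegral_gaussian (by norm_num)] at h
  have h2 := (Complex.continuous_re.tendsto _).comp h
  rw [← Filter.tendsto_add_atTop_iff_nat 1]
  convert! h2 using 2
  · rename_i n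
    simp only [Function.comp]
    rw [← scaled_inversion n x _ (by positivity)]
    have e : (((n + 1 : ℕ) : ℝ) + 1) = ((n + 2 : ℕ) : ℝ) := by push_cast; ring
    rw [e, bsC, ← Complex.ofReal_mul, Complex.ofReal_re]
  · have e1 : ((Real.pi : ℂ) / (1 / 2)) ^ (1 / 2 : ℂ) = ((√(2 * Real.pi) : ℝ) : ℂ) := by
      rw [Real.sqrt_eq_rpow, Complex.ofReal_cpow (by positivity)]
      push_cast
      congr 1; ring
    have e2 : Complex.exp (-(x : ℂ) ^ 2 / (4 * (1 / 2))) = ((Real.exp (-x ^ 2 / 2) : ℝ) : ℂ) := by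
      push_cast; congr 1; ring
    have e3 : (1 / (2 * Real.pi) : ℂ) = ((1 / (2 * Real.pi) : ℝ) : ℂ) := by push_cast; rfl
    rw [e1, e2, e3, ← Complex.ofReal_mul, ← Complex.ofReal_mul, Complex.ofReal_re, ← mul_assoc]
    congr 1
    have : √(2 * Real.pi) ^ 2 = 2 * Real.pi := Real.sq_sqrt (by positivity)
    have hp : 0 < √(2 * Real.pi) := by positivity
    rw [div_mul_eq_mul_div, div_eq_div_iff hp.ne' (by positivity)]
    linarith
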